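/- Let σ_1, …, σ_M be pairwise distinct Pauli strings on n qubits and let 1 ≤ h ≤ M be such that: (i) σ_i σ_j = σ_j σ_i for all i, j ≤ h, and (ii) for every i with h < i ≤ M there exists j ≤ h with σ_j σ_i ≠ σ_i σ_j. Then any real linear combination m = Σ_{i=1}^{M} a_i σ_i that commutes with σ_j for every j ≤ h satisfies a_i = 0 for all i > h; in other words, the real span of σ_1, …, σ_h is a maximal abelian subspace of the real span of σ_1, …, σ_M. -/

import Mathlib

open Matrix

/-- The Pauli matrix `X`. -/
noncomputable def PauliX : Matrix (Fin 2) (Fin 2) ℂ := !![0, 1; 1, 0]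
/-- The Pauli matrix `Y`. -/
noncomputable def PauliY : Matrix (Fin 2) (Fin 2) ℂ := !![0, -Complex.I; Complex.I, 0]
/-- The Pauli matrix `Z`. -/
noncomputable def PauliZ : Matrix (Fin 2) (Fin 2) ℂ := !![1, 0; 0, -1]

/-- The `n`-fold Kronecker (tensor) product of the one-qubit matrices `f 0, …, f (n-1)`,
realized as a `2ⁿ × 2ⁿ` matrix indexed by `Fin n → Fin 2`. -/
noncomputable def pauliString {n : ℕ} (f : Fin n → Matrix (Fin 2) (Fin 2) ℂ) :
    Matrix (Fin n → Fin 2) (Fin n → Fin 2) ℂ :=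
  Matrix.of fun p q => ∏ i, f i (p i) (q i)

/-- A matrix is a Pauli string on `n` qubits if it is the Kronecker product of `n`
factors, each of which is the identity or one of the Pauli matrices `X`, `Y`, `Z`. -/
def IsPauliString {n : ℕ} (σ : Matrix (Fin n → Fin 2) (Fin n → Fin 2) ℂ) : Prop :=
  ∃ f : Fin n → Matrix (Fin 2) (Fin 2) ℂ,
    (∀ i, f i = 1 ∨ f i = PauliX ∨ f i = PauliY ∨ f i = PauliZ) ∧ σ = pauliString f


/-- A one-qubit Pauli matrix: the identity, `X`, `Y` or `Z`. -/
def IsPauliMatrix (A : Matrix (Fin 2) (Fin 2) ℂ) : Prop :=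
  A = 1 ∨ A = PauliX ∨ A = PauliY ∨ A = PauliZ

theorem IsPauliMatrix.mul_self {A : Matrix (Fin 2) (Fin 2) ℂ} (hA : IsPauliMatrix A) :
    A * A = 1 := by
  rcases hA with rfl | rfl | rfl | rfl <;>
    simp [PauliX, PauliY, PauliZ, Matrix.one_fin_two]

theorem IsPauliMatrix.exists_sign_mul_eq {A B : Matrix (Fin 2) (Fin 2) ℂ}
    (hA : IsPauliMatrix A) (hB : IsPauliMatrix B) :
    ∃ s : ℤˣ, A * B = ((s : ℤ) : ℂ) • (B * A) := by
  rcases hA with rfl | rfl | rfl | rfl <;> rcases hB with rfl | rfl | rfl | rfl <;>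
    first
    | (refine ⟨1, ?_⟩; simp; done)
    | (refine ⟨-1, ?_⟩; simp [PauliX, PauliY, PauliZ])

theorem IsPauliMatrix.trace_mul_eq_zero {A B : Matrix (Fin 2) (Fin 2) ℂ}
    (hA : IsPauliMatrix A) (hB : IsPauliMatrix B) (hAB : A ≠ B) : (A * B).trace = 0 := by
  rcases hA with rfl | rfl | rfl | rfl <;> rcases hB with rfl | rfl | rfl | rfl <;>
    first
    | exact absurd rfl hAB
    | simp [PauliX, PauliY, PauliZ, Matrix.trace_fin_two]

theorem pauliString_mul {n : ℕ} (f g : Fin n → Matrix (Fin 2) (Fin 2) ℂ) :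
    pauliString f * pauliString g = pauliString fun i => f i * g i := by
  ext p q
  simp only [pauliString, Matrix.mul_apply, Matrix.of_apply, ← Finset.prod_mul_distrib]
  exact (Fintype.prod_sum fun i k => f i (p i) k * g i k (q i)).symm

theorem pauliString_smul {n : ℕ} (c : Fin n → ℂ) (f : Fin n → Matrix (Fin 2) (Fin 2) ℂ) :
    (pauliString fun i => c i • f i) = (∏ i, c i) • pauliString f := by
  ext p q
  simp [pauliString, Finset.prod_mul_distrib]

theorem pauliString_one {n : ℕ} :
    (pauliString fun _ : Fin n => (1 : Matrix (Fin 2) (Fin 2) ℂ)) = 1 := by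
  ext p q
  simp [pauliString, Matrix.one_apply, Finset.prod_ite_zero, funext_iff]

theorem trace_pauliString {n : ℕ} (f : Fin n → Matrix (Fin 2) (Fin 2) ℂ) :
    (pauliString f).trace = ∏ i, (f i).trace :=
  (Fintype.prod_sum fun i k => f i k k).symm

section IsPauliString

variable {n : ℕ} {σ τ : Matrix (Fin n → Fin 2) (Fin n → Fin 2) ℂ}

theorem IsPauliString.mul_self (hσ : IsPauliString σ) : σ * σ = 1 := by
  obtain ⟨f, hf, rfl⟩ := hσ
  rw [pauliString_mul, funext fun i => IsPauliMatrix.mul_self (hf i), pauliString_one]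

theorem IsPauliString.commute_or_anticommute (hσ : IsPauliString σ) (hτ : IsPauliString τ) :
    σ * τ = τ * σ ∨ σ * τ = -(τ * σ) := by
  obtain ⟨f, hf, rfl⟩ := hσ
  obtain ⟨g, hg, rfl⟩ := hτ
  choose s hs using fun i => IsPauliMatrix.exists_sign_mul_eq (hf i) (hg i)
  have key : pauliString f * pauliString g =
      (((∏ i, s i : ℤˣ) : ℤ) : ℂ) • (pauliString g * pauliString f) := by
    rw [pauliString_mul, pauliString_mul, funext hs, pauliString_smul]
    push_cast
    rfl
  rcases Int.units_eq_one_or (∏ i, s i) with h | h <;> rw [h] at key <;> simp [key]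

theorem IsPauliString.trace_mul_eq_zero (hσ : IsPauliString σ) (hτ : IsPauliString τ)
    (hne : σ ≠ τ) : (σ * τ).trace = 0 := by
  obtain ⟨f, hf, rfl⟩ := hσ
  obtain ⟨g, hg, rfl⟩ := hτ
  obtain ⟨i, hi⟩ := Function.ne_iff.mp (ne_of_apply_ne pauliString hne)
  rw [pauliString_mul, trace_pauliString]
  exact Finset.prod_eq_zero (Finset.mem_univ i) (IsPauliMatrix.trace_mul_eq_zero (hf i) (hg i) hi)

/-- A matrix commuting with a Pauli string `σ` is trace-orthogonal to every Pauli string that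
does not commute with `σ`. -/
theorem IsPauliString.trace_mul_eq_zero_of_commute (hσ : IsPauliString σ)
    (hτ : IsPauliString τ) (hστ : σ * τ ≠ τ * σ)
    {m : Matrix (Fin n → Fin 2) (Fin n → Fin 2) ℂ} (hm : m * σ = σ * m) :
    (m * τ).trace = 0 := by
  have anti := (hσ.commute_or_anticommute hτ).resolve_left hστ
  refine self_eq_neg.mp ?_
  calc (m * τ).trace = (m * (σ * σ) * τ).trace := by rw [hσ.mul_self, mul_one]
    _ = (σ * (m * (σ * τ))).trace := by rw [← mul_assoc m, hm]; simp only [mul_assoc]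
    _ = (m * (σ * τ) * σ).trace := Matrix.trace_mul_comm _ _
    _ = -(m * τ * (σ * σ)).trace := by
      rw [anti, ← Matrix.trace_neg]; simp only [mul_assoc, mul_neg, neg_mul]
    _ = -(m * τ).trace := by rw [hσ.mul_self, mul_one]

theorem trace_sum_smul_mul {ι : Type*} [Fintype ι]
    {σ : ι → Matrix (Fin n → Fin 2) (Fin n → Fin 2) ℂ} (hP : ∀ i, IsPauliString (σ i))
    (hdist : Function.Injective σ) (a : ι → ℂ) (i : ι) :
    ((∑ k, a k • σ k) * σ i).trace = a i * 2 ^ n := by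
  rw [Finset.sum_mul, Matrix.trace_sum, Fintype.sum_eq_single i]
  · rw [Matrix.smul_mul, Matrix.trace_smul, (hP i).mul_self, Matrix.trace_one]
    simp
  · intro k hk
    rw [Matrix.smul_mul, Matrix.trace_smul, (hP k).trace_mul_eq_zero (hP i) (hdist.ne hk),
      smul_zero]

end IsPauliString

/-- Let `σ 0, …, σ (M-1)` be pairwise distinct Pauli strings on `n`
qubits and `1 ≤ h ≤ M` be such that (i) the first `h` strings pairwise commute and
(ii) each of the remaining strings fails to commute with at least one of the first
`h`.  Then any real linear combination `m = Σᵢ aᵢ σᵢ` commuting with each of the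
first `h` strings has `aᵢ = 0` for every `i ≥ h`: the real span of the first `h`
strings is a maximal abelian subspace of the real span of all of them. -/
theorem maximal_abelian_subalgebra {n M : ℕ}
    (σ : Fin M → Matrix (Fin n → Fin 2) (Fin n → Fin 2) ℂ)
    (hP : ∀ i, IsPauliString (σ i)) (hdist : Function.Injective σ)
    (h : ℕ) (h1 : 1 ≤ h) (hM : h ≤ M)
    (hcomm : ∀ i j : Fin M, i.val < h → j.val < h → σ i * σ j = σ j * σ i)
    (hnoncomm : ∀ i : Fin M, h ≤ i.val → ∃ j : Fin M, j.val < h ∧ σ j * σ i ≠ σ i * σ j)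
    (a : Fin M → ℝ)
    (hacomm : ∀ j : Fin M, j.val < h →
      (∑ i, (a i : ℂ) • σ i) * σ j = σ j * (∑ i, (a i : ℂ) • σ i)) :
    ∀ i : Fin M, h ≤ i.val → a i = 0 := by
  intro i hi
  obtain ⟨j, hj, hne⟩ := hnoncomm i hi
  have htr := (hP j).trace_mul_eq_zero_of_commute (hP i) hne (hacomm j hj)
  rw [trace_sum_smul_mul hP hdist] at htr
  simpa using htr
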